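/- For every q with 0 ≤ q < 1 and every y ∈ ℝ, Σ_{λ} Σ_{μ ⊆ λ} q^{|μ|} · ( dim(λ/μ) )² · y^{2(|λ|−|μ|)} / ( (|λ|−|μ|)! )² = e^{y²/(1−q)} · ∏_{k=1}^∞ (1 − q^k)^{−1}, where the outer sum runs over all partitions λ and the inner sum over all partitions μ contained in λ; in particular the double sum converges. -/

import Mathlib

/-- An integer partition: a weakly decreasing sequence of nonnegative integers with only
finitely many nonzero terms; `part i` is the `(i+1)`-st part `λ_{i+1}`. -/
structure IntPartition where
  part : ℕ → ℕ
  antitone : Antitone part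
  finite_supp : (Function.support part).Finite

/-- The size `|λ| = Σ_i λ_i` of a partition. -/
noncomputable def IntPartition.size (lam : IntPartition) : ℕ := ∑ᶠ i, lam.part i

/-- `dim(λ/μ)`: the number of saturated chains `μ = ν⁰ ⊆ ν¹ ⊆ ⋯ ⊆ νᵐ = λ` of partitions
with `|νᵏ| = |νᵏ⁻¹| + 1` for all `k`, where `m = |λ| − |μ|` (equivalently, the number of
standard Young tableaux of skew shape `λ/μ`); chains are encoded as sequences
`f : ℕ → IntPartition` constant equal to `λ` from index `m` on. -/
noncomputable def skewDim (mu lam : IntPartition) : ℕ :=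
  Set.ncard {f : ℕ → IntPartition |
    f 0 = mu ∧ (∀ k : ℕ, lam.size - mu.size ≤ k → f k = lam) ∧
    ∀ k : ℕ, k < lam.size - mu.size →
      (∀ i : ℕ, (f k).part i ≤ (f (k + 1)).part i) ∧ (f (k + 1)).size = (f k).size + 1}

open scoped ENNReal

namespace IntPartition

theorem ext_part {lam mu : IntPartition} (h : lam.part = mu.part) : lam = mu := by
  cases lam; cases mu; congr

theorem exists_part_eq_zero (lam : IntPartition) : ∃ N, ∀ i, N ≤ i → lam.part i = 0 := by
  obtain ⟨N, hN⟩ := lam.finite_supp.bddAbove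
  refine ⟨N + 1, fun i hi => ?_⟩
  by_contra h
  have := hN (Function.mem_support.2 h)
  omega

theorem size_eq_sum_range (lam : IntPartition) {N : ℕ} (h : ∀ i, N ≤ i → lam.part i = 0) :
    lam.size = ∑ i ∈ Finset.range N, lam.part i := by
  refine finsum_eq_sum_of_support_subset _ fun i hi => ?_
  by_contra hc
  exact hi (h i (by simpa using hc))

theorem size_le_size {mu lam : IntPartition} (h : ∀ i, mu.part i ≤ lam.part i) :
    mu.size ≤ lam.size := by
  obtain ⟨N, hN⟩ := lam.exists_part_eq_zero
  rw [lam.size_eq_sum_range hN,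
    mu.size_eq_sum_range fun i hi => Nat.le_zero.1 ((h i).trans (hN i hi).le)]
  exact Finset.sum_le_sum fun i _ => h i

theorem eq_of_le_of_size_le {mu lam : IntPartition} (h : ∀ i, mu.part i ≤ lam.part i)
    (hs : lam.size ≤ mu.size) : mu = lam := by
  obtain ⟨N, hN⟩ := lam.exists_part_eq_zero
  have hM : ∀ i, N ≤ i → mu.part i = 0 := fun i hi => Nat.le_zero.1 ((h i).trans (hN i hi).le)
  have hs' := le_antisymm (size_le_size h) hs
  rw [lam.size_eq_sum_range hN, mu.size_eq_sum_range hM,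
    Finset.sum_eq_sum_iff_of_le fun i _ => h i] at hs'
  refine ext_part (funext fun i => ?_)
  by_cases hi : i < N
  · exact hs' i (Finset.mem_range.2 hi)
  · rw [hN i (by omega), hM i (by omega)]

/-- The union of two partitions. -/
def join (mu lam : IntPartition) : IntPartition where
  part i := max (mu.part i) (lam.part i)
  antitone := mu.antitone.max lam.antitone
  finite_supp := (mu.finite_supp.union lam.finite_supp).subset fun i hi => by
    by_contra hc
    simp_all

/-- The intersection of two partitions. -/
def meet (mu lam : IntPartition) : IntPartition where
  part i := min (mu.part i) (lam.part i)
  antitone := mu.antitone.min lam.antitone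
  finite_supp := mu.finite_supp.subset fun i hi => by
    by_contra hc
    simp_all

theorem size_join_add_size_meet (mu lam : IntPartition) :
    (mu.join lam).size + (mu.meet lam).size = mu.size + lam.size := by
  obtain ⟨M, hM⟩ := mu.exists_part_eq_zero
  obtain ⟨N, hN⟩ := lam.exists_part_eq_zero
  have hM' : ∀ i, max M N ≤ i → mu.part i = 0 := fun i hi => hM i ((le_max_left _ _).trans hi)
  have hN' : ∀ i, max M N ≤ i → lam.part i = 0 := fun i hi => hN i ((le_max_right _ _).trans hi)
  rw [mu.size_eq_sum_range hM', lam.size_eq_sum_range hN',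
    (mu.join lam).size_eq_sum_range (N := max M N) fun i hi => by simp [join, hM' i hi, hN' i hi],
    (mu.meet lam).size_eq_sum_range (N := max M N) fun i hi => by simp [meet, hM' i hi],
    ← Finset.sum_add_distrib, ← Finset.sum_add_distrib]
  exact Finset.sum_congr rfl fun i _ => max_add_min _ _

/-- `lam` is obtained from `mu` by adding one box. -/
def Covers (mu lam : IntPartition) : Prop :=
  (∀ i, mu.part i ≤ lam.part i) ∧ lam.size = mu.size + 1

theorem size_eq_of_part_eq_add_single {mu lam : IntPartition} {i : ℕ}
    (h : lam.part = mu.part + Pi.single i 1) : lam.size = mu.size + 1 := by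
  obtain ⟨M, hM⟩ := mu.exists_part_eq_zero
  have hM' : ∀ j, M + i + 1 ≤ j → mu.part j = 0 := fun j hj => hM j (by omega)
  rw [mu.size_eq_sum_range hM', lam.size_eq_sum_range (N := M + i + 1) fun j hj => by
    simp [h, hM' j hj, show j ≠ i by omega]]
  simp [h, Finset.sum_add_distrib, Pi.single_apply]

theorem covers_iff {mu lam : IntPartition} :
    Covers mu lam ↔ ∃ i, lam.part = mu.part + Pi.single i 1 := by
  constructor
  · rintro ⟨h, hs⟩
    have hex : ∃ i, mu.part i < lam.part i := by
      by_contra! hc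
      have : mu = lam := ext_part (funext fun i => le_antisymm (h i) (hc i))
      subst this
      omega
    obtain ⟨N, hN⟩ := lam.exists_part_eq_zero
    have hM : ∀ i, N ≤ i → mu.part i = 0 := fun i hi => Nat.le_zero.1 ((h i).trans (hN i hi).le)
    obtain ⟨i, hi⟩ := hex
    have hiN : i < N := by
      by_contra hc
      rw [hN i (by omega)] at hi
      omega
    refine ⟨i, funext fun j => ?_⟩
    have hle : ∀ j ∈ Finset.range N, (mu.part + Pi.single i 1 : ℕ → ℕ) j ≤ lam.part j := by
      intro j _
      by_cases hj : j = i
      · subst hj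
        simpa using hi
      · simpa [Pi.single_apply, hj] using h j
    rw [lam.size_eq_sum_range hN, mu.size_eq_sum_range hM] at hs
    have hsum : ∑ j ∈ Finset.range N, (mu.part + Pi.single i 1 : ℕ → ℕ) j
        = ∑ j ∈ Finset.range N, lam.part j := by
      rw [hs]
      simp [Finset.sum_add_distrib, Pi.single_apply, hiN]
    by_cases hj : j < N
    · exact ((Finset.sum_eq_sum_iff_of_le hle).1 hsum j (Finset.mem_range.2 hj)).symm
    · simp [hN j (by omega), hM j (by omega), show j ≠ i by omega]
  · rintro ⟨i, h⟩
    exact ⟨fun j => by simp [h], size_eq_of_part_eq_add_single h⟩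

theorem exists_add_single_iff (mu : IntPartition) (i : ℕ) :
    (∃ lam : IntPartition, lam.part = mu.part + Pi.single i 1) ↔
      i = 0 ∨ mu.part i < mu.part (i - 1) := by
  constructor
  · rintro ⟨lam, h⟩
    by_cases hi : i = 0
    · exact Or.inl hi
    · right
      have h1 := lam.antitone (Nat.sub_le i 1)
      simp only [h, Pi.add_apply, Pi.single_apply, show i - 1 ≠ i by omega, if_true, if_false] at h1
      omega
  · intro h
    refine ⟨⟨mu.part + Pi.single i 1, antitone_nat_of_succ_le fun j => ?_, ?_⟩, rfl⟩
    · have h1 := mu.antitone (Nat.le_succ j)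
      simp only [Pi.add_apply, Pi.single_apply]
      by_cases hj : j + 1 = i
      · subst hj
        simp at h ⊢
        omega
      · simp only [hj, if_false]
        exact h1.trans (Nat.le_add_right _ _)
    · refine (mu.finite_supp.union (Set.finite_singleton i)).subset fun j hj => ?_
      by_contra hc
      simp_all [Pi.single_apply]

theorem exists_eq_add_single_iff (mu : IntPartition) (i : ℕ) :
    (∃ nu : IntPartition, mu.part = nu.part + Pi.single i 1) ↔
      mu.part (i + 1) < mu.part i := by
  constructor
  · rintro ⟨nu, h⟩
    have h1 := nu.antitone (Nat.le_succ i)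
    simp only [h, Pi.add_apply, Pi.single_apply, show i + 1 ≠ i by omega, if_true, if_false]
    simp at h1
    omega
  · intro h
    refine ⟨⟨mu.part - Pi.single i 1, antitone_nat_of_succ_le fun j => ?_, ?_⟩, ?_⟩
    · have h1 := mu.antitone (Nat.le_succ j)
      simp only [Pi.sub_apply, Pi.single_apply]
      by_cases hj : j = i
      · subst hj
        simp
        omega
      · simp only [hj, if_false]
        exact (Nat.sub_le _ _).trans h1
    · refine mu.finite_supp.subset fun j hj hc => hj ?_
      simp [hc]
    · funext j
      simp only [Pi.sub_apply, Pi.add_apply, Pi.single_apply]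
      split_ifs with hj
      · subst hj
        omega
      · simp

open scoped Classical in
theorem tsum_ite_of_subsingleton {α : Type*} (P : α → Prop) (h : ∀ a b, P a → P b → a = b) :
    ∑' a, (if P a then (1 : ℝ≥0∞) else 0) = if ∃ a, P a then 1 else 0 := by
  split_ifs with hP
  · obtain ⟨a, ha⟩ := hP
    rw [tsum_eq_single a fun b hb => if_neg fun hPb => hb (h b a hPb ha), if_pos ha]
  · push Not at hP
    simp [hP]

open scoped Classical in
/-- The indicator of the covering relation. -/
noncomputable def adj (mu lam : IntPartition) : ℝ≥0∞ := if Covers mu lam then 1 else 0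

open scoped Classical in
theorem adj_eq_tsum (mu lam : IntPartition) :
    adj mu lam = ∑' i : ℕ, if lam.part = mu.part + Pi.single i 1 then 1 else 0 := by
  rw [tsum_ite_of_subsingleton, adj]
  · simp only [covers_iff]
  · intro i j hi hj
    have h := congrFun (add_left_cancel (hi.symm.trans hj)) i
    by_contra hc
    simp [hc] at h

theorem tsum_adj_right (mu : IntPartition) :
    ∑' lam, adj mu lam = ∑' i : ℕ, if i = 0 ∨ mu.part i < mu.part (i - 1) then 1 else 0 := by
  classical
  simp only [adj_eq_tsum]
  rw [ENNReal.tsum_comm]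
  refine tsum_congr fun i => ?_
  rw [tsum_ite_of_subsingleton _ fun a b ha hb => ext_part (ha.trans hb.symm)]
  simp only [exists_add_single_iff]

theorem tsum_adj_left (mu : IntPartition) :
    ∑' nu, adj nu mu = ∑' i : ℕ, if mu.part (i + 1) < mu.part i then 1 else 0 := by
  classical
  simp only [adj_eq_tsum]
  rw [ENNReal.tsum_comm]
  refine tsum_congr fun i => ?_
  rw [tsum_ite_of_subsingleton _ fun a b ha hb =>
    ext_part (add_right_cancel (ha.symm.trans hb))]
  simp only [exists_eq_add_single_iff]

theorem adj_mul_self (mu lam : IntPartition) : adj mu lam * adj mu lam = adj mu lam := by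
  unfold adj
  split_ifs <;> simp

theorem tsum_adj_mul_self (mu : IntPartition) :
    ∑' lam, adj mu lam * adj mu lam = ∑' nu, adj nu mu * adj nu mu + 1 := by
  simp only [adj_mul_self]
  rw [tsum_adj_right, tsum_adj_left, tsum_eq_zero_add' ENNReal.summable, add_comm]
  simp

theorem tsum_adj_mul_of_ne {mu kap : IntPartition} (hne : mu ≠ kap) :
    ∑' lam, adj mu lam * adj kap lam = ∑' nu, adj nu mu * adj nu kap := by
  have hJM := size_join_add_size_meet mu kap
  have hl : ∀ i, mu.part i ≤ (mu.join kap).part i := fun i => le_max_left _ _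
  have hr : ∀ i, kap.part i ≤ (mu.join kap).part i := fun i => le_max_right _ _
  have hl' : ∀ i, (mu.meet kap).part i ≤ mu.part i := fun i => min_le_left _ _
  have hr' : ∀ i, (mu.meet kap).part i ≤ kap.part i := fun i => min_le_right _ _
  rw [tsum_eq_single (mu.join kap), tsum_eq_single (mu.meet kap)]
  · unfold adj Covers
    simp only [hl, hr, hl', hr', implies_true, true_and]
    split_ifs <;> first | rfl | omega | simp
  · intro nu hnu
    unfold adj
    split_ifs with h1 h2 <;> try simp
    refine hnu (eq_of_le_of_size_le (fun i => le_min (h1.1 i) (h2.1 i)) ?_)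
    by_contra hc
    have h3 := h1.2
    have h4 := h2.2
    have h5 := eq_of_le_of_size_le hl' (by omega)
    have h6 := eq_of_le_of_size_le hr' (by omega)
    exact hne (h5.symm.trans h6)
  · intro lam hlam
    unfold adj
    split_ifs with h1 h2 <;> try simp
    refine hlam (eq_of_le_of_size_le (fun i => max_le (h1.1 i) (h2.1 i)) ?_).symm
    by_contra hc
    have h3 := h1.2
    have h4 := h2.2
    have h5 := eq_of_le_of_size_le hl (by omega)
    have h6 := eq_of_le_of_size_le hr (by omega)
    exact hne (h5.trans h6.symm)

open scoped Classical in
theorem tsum_adj_mul (mu kap : IntPartition) :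
    ∑' lam, adj mu lam * adj kap lam =
      ∑' nu, adj nu mu * adj nu kap + if mu = kap then 1 else 0 := by
  split_ifs with h
  · subst h
    exact tsum_adj_mul_self mu
  · rw [add_zero, tsum_adj_mul_of_ne h]

open scoped Classical in
/-- The number of saturated chains of length `n` from `mu` to `lam`. -/
noncomputable def chainCount : ℕ → IntPartition → IntPartition → ℝ≥0∞
  | 0, mu, lam => if mu = lam then 1 else 0
  | n + 1, mu, lam => ∑' kap, adj mu kap * chainCount n kap lam

theorem chainCount_succ (n : ℕ) (mu lam : IntPartition) :
    chainCount (n + 1) mu lam = ∑' kap, adj mu kap * chainCount n kap lam := rfl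

theorem tsum_mul_chainCount_zero (f : IntPartition → ℝ≥0∞) (lam : IntPartition) :
    ∑' kap, f kap * chainCount 0 kap lam = f lam := by
  rw [tsum_eq_single lam fun b hb => by simp [chainCount, hb]]
  simp [chainCount]

theorem tsum_chainCount_zero_mul (f : IntPartition → ℝ≥0∞) (mu : IntPartition) :
    ∑' kap, chainCount 0 mu kap * f kap = f mu := by
  rw [tsum_eq_single mu fun b hb => by simp [chainCount, hb.symm]]
  simp [chainCount]

theorem tsum_chainCount_succ_mul (n : ℕ) (mu : IntPartition) (f : IntPartition → ℝ≥0∞) :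
    ∑' lam, chainCount (n + 1) mu lam * f lam =
      ∑' rho, adj mu rho * ∑' lam, chainCount n rho lam * f lam := by
  simp only [chainCount_succ, ← ENNReal.tsum_mul_right, ← ENNReal.tsum_mul_left]
  rw [ENNReal.tsum_comm]
  simp only [mul_assoc]

theorem chainCount_succ' (n : ℕ) (mu lam : IntPartition) :
    chainCount (n + 1) mu lam = ∑' kap, chainCount n mu kap * adj kap lam := by
  induction n generalizing mu with
  | zero => rw [chainCount_succ, tsum_mul_chainCount_zero, tsum_chainCount_zero_mul]
  | succ n ih => rw [chainCount_succ, tsum_chainCount_succ_mul]; simp only [ih]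

theorem tsum_chainCount_mul_adj (n : ℕ) (mu kap : IntPartition) :
    ∑' lam, chainCount (n + 1) mu lam * adj kap lam =
      ∑' nu, adj nu mu * chainCount (n + 1) nu kap + (n + 1) * chainCount n mu kap := by
  have key (n : ℕ) (mu : IntPartition) : ∑' rho, adj mu rho * ∑' nu, adj nu rho * chainCount n nu kap =
      ∑' nu, adj nu mu * chainCount (n + 1) nu kap + chainCount n mu kap := by
    classical
    calc _ = ∑' nu, (∑' rho, adj mu rho * adj nu rho) * chainCount n nu kap := by
          simp only [← ENNReal.tsum_mul_right, ← ENNReal.tsum_mul_left]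
          rw [ENNReal.tsum_comm]
          simp only [mul_assoc]
      _ = ∑' nu, ((∑' sig, adj sig mu * adj sig nu) * chainCount n nu kap +
            chainCount 0 mu nu * chainCount n nu kap) := by
          simp only [tsum_adj_mul, add_mul, chainCount]
      _ = _ := by
          rw [ENNReal.tsum_add, tsum_chainCount_zero_mul (fun nu => chainCount n nu kap) mu]
          congr 1
          simp only [chainCount_succ, ← ENNReal.tsum_mul_right, ← ENNReal.tsum_mul_left]
          rw [ENNReal.tsum_comm]
          simp only [mul_assoc]
  induction n generalizing mu with
  | zero =>
    rw [tsum_chainCount_succ_mul]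
    simp only [tsum_chainCount_zero_mul]
    have h := key 0 mu
    simp only [tsum_mul_chainCount_zero] at h
    simpa using h
  | succ n ih =>
    rw [tsum_chainCount_succ_mul]
    simp only [ih, mul_add, ENNReal.tsum_add]
    rw [key, Nat.cast_succ, add_mul _ 1, one_mul, add_assoc, add_comm (chainCount _ _ _)]
    congr 2
    rw [chainCount_succ, ← ENNReal.tsum_mul_left]
    exact tsum_congr fun rho => by ring

theorem tsum_weight_chainCount_sq (w : ℕ → ℝ≥0∞) (n : ℕ) :
    ∑' mu : IntPartition, w mu.size * ∑' lam, chainCount (n + 1) mu lam ^ 2 =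
      ∑' mu : IntPartition, w (mu.size + 1) * ∑' lam, chainCount (n + 1) mu lam ^ 2 +
        (n + 1) * ∑' mu : IntPartition, w mu.size * ∑' lam, chainCount n mu lam ^ 2 := by
  have hw (nu mu : IntPartition) : w mu.size * adj nu mu = w (nu.size + 1) * adj nu mu := by
    unfold adj
    split_ifs with h
    · rw [h.2]
    · simp
  have h1 (mu : IntPartition) : ∑' lam, chainCount (n + 1) mu lam ^ 2 =
      ∑' kap, chainCount n mu kap * ∑' nu, adj nu mu * chainCount (n + 1) nu kap +
        (n + 1) * ∑' kap, chainCount n mu kap ^ 2 := by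
    calc _ = ∑' lam, ∑' kap, chainCount (n + 1) mu lam * (chainCount n mu kap * adj kap lam) := by
          refine tsum_congr fun lam => ?_
          rw [ENNReal.tsum_mul_left, ← chainCount_succ', sq]
      _ = ∑' kap, chainCount n mu kap * ∑' lam, chainCount (n + 1) mu lam * adj kap lam := by
          rw [ENNReal.tsum_comm]
          simp only [← ENNReal.tsum_mul_left]
          exact tsum_congr fun kap => tsum_congr fun lam => by ring
      _ = _ := by
          simp only [tsum_chainCount_mul_adj, mul_add, ENNReal.tsum_add, ← ENNReal.tsum_mul_left]
          congr 1
          exact tsum_congr fun kap => by ring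
  calc _ = ∑' mu : IntPartition, ∑' kap, ∑' nu,
          w mu.size * (chainCount n mu kap * (adj nu mu * chainCount (n + 1) nu kap)) +
        (n + 1) * ∑' mu : IntPartition, w mu.size * ∑' lam, chainCount n mu lam ^ 2 := by
        simp only [h1, mul_add, ENNReal.tsum_add, ← ENNReal.tsum_mul_left]
        congr 1
        exact tsum_congr fun mu => tsum_congr fun kap => by ring
    _ = ∑' nu : IntPartition, ∑' kap, ∑' mu,
          w (nu.size + 1) * (chainCount (n + 1) nu kap * (adj nu mu * chainCount n mu kap)) +
        (n + 1) * ∑' mu : IntPartition, w mu.size * ∑' lam, chainCount n mu lam ^ 2 := by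
        congr 1
        rw [ENNReal.tsum_comm]
        conv_rhs => rw [ENNReal.tsum_comm]
        refine tsum_congr fun kap => ?_
        rw [ENNReal.tsum_comm]
        refine tsum_congr fun nu => tsum_congr fun mu => ?_
        calc _ = w mu.size * adj nu mu * (chainCount n mu kap * chainCount (n + 1) nu kap) := by
              ring
          _ = _ := by rw [hw]; ring
    _ = _ := by
        simp only [ENNReal.tsum_mul_left, ← chainCount_succ, sq]

/-- The number of pairs of saturated chains of length `n` with common endpoints, starting at a
partition of size `N`. -/
noncomputable def chainPairCount (n N : ℕ) : ℝ≥0∞ :=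
  ∑' mu : IntPartition, (if mu.size = N then 1 else 0) * ∑' lam, chainCount n mu lam ^ 2

theorem chainPairCount_succ (n N : ℕ) :
    chainPairCount (n + 1) N = (n + 1) * ∑ k ∈ Finset.range (N + 1), chainPairCount n k := by
  induction N with
  | zero =>
    unfold chainPairCount
    rw [tsum_weight_chainCount_sq (fun m => if m = 0 then 1 else 0)]
    simp
  | succ N ih =>
    rw [Finset.sum_range_succ, mul_add, ← ih]
    unfold chainPairCount
    rw [tsum_weight_chainCount_sq (fun m => if m = N + 1 then 1 else 0)]
    simp

theorem tsum_pow_mul_chainPairCount (q : ℝ≥0∞) (n : ℕ) :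
    ∑' N, q ^ N * chainPairCount n N =
      ∑' mu : IntPartition, q ^ mu.size * ∑' lam, chainCount n mu lam ^ 2 := by
  simp only [chainPairCount, ← ENNReal.tsum_mul_left]
  rw [ENNReal.tsum_comm]
  refine tsum_congr fun mu => ?_
  rw [ENNReal.tsum_comm]
  refine tsum_congr fun lam => ?_
  rw [tsum_eq_single mu.size fun N hN => by simp [hN.symm]]
  simp

theorem tsum_pow_mul_sum_range (q : ℝ≥0∞) (f : ℕ → ℝ≥0∞) :
    ∑' N, q ^ N * ∑ k ∈ Finset.range (N + 1), f k = (1 - q)⁻¹ * ∑' N, q ^ N * f N := by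
  calc _ = ∑' N, ∑' p : Finset.HasAntidiagonal.antidiagonal N, q ^ p.1.1 * f p.1.1 * q ^ p.1.2 := by
        refine tsum_congr fun N => ?_
        rw [Finset.tsum_subtype (Finset.HasAntidiagonal.antidiagonal N) (fun p => q ^ p.1 * f p.1 * q ^ p.2),
          Finset.Nat.sum_antidiagonal_eq_sum_range_succ (fun i j => q ^ i * f i * q ^ j),
          Finset.mul_sum]
        refine Finset.sum_congr rfl fun k hk => ?_
        have hk' := Finset.mem_range.1 hk
        rw [mul_right_comm, ← pow_add, show k + (N - k) = N by omega]
    _ = ∑' p : ℕ × ℕ, q ^ p.1 * f p.1 * q ^ p.2 := by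
        rw [← Finset.HasAntidiagonal.sigmaAntidiagonalEquivProd.tsum_eq, ENNReal.tsum_sigma']
        rfl
    _ = _ := by
        rw [ENNReal.tsum_prod (f := fun i j => q ^ i * f i * q ^ j)]
        simp only [ENNReal.tsum_mul_left, ENNReal.tsum_mul_right, ENNReal.tsum_geometric]
        rw [mul_comm]

theorem tsum_pow_size_mul_chainCount_sq (q : ℝ≥0∞) (n : ℕ) :
    ∑' mu : IntPartition, q ^ mu.size * ∑' lam, chainCount n mu lam ^ 2 =
      n.factorial * (1 - q)⁻¹ ^ n * ∑' mu : IntPartition, q ^ mu.size := by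
  induction n with
  | zero =>
    simp only [sq, tsum_chainCount_zero_mul (fun lam => chainCount 0 _ lam)]
    simp [chainCount]
  | succ n ih =>
    rw [← tsum_pow_mul_chainPairCount]
    simp only [chainPairCount_succ, mul_left_comm _ ((n : ℝ≥0∞) + 1), ENNReal.tsum_mul_left]
    rw [tsum_pow_mul_sum_range, tsum_pow_mul_chainPairCount, ih, Nat.factorial_succ]
    push_cast
    ring

theorem le_and_size_of_chainCount_ne_zero {n : ℕ} {mu lam : IntPartition}
    (h : chainCount n mu lam ≠ 0) :
    (∀ i, mu.part i ≤ lam.part i) ∧ lam.size = mu.size + n := by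
  induction n generalizing mu with
  | zero =>
    have : mu = lam := by
      by_contra hc
      exact h (by simp [chainCount, hc])
    subst this
    exact ⟨fun _ => le_rfl, rfl⟩
  | succ n ih =>
    rw [chainCount_succ, Ne, ENNReal.tsum_eq_zero] at h
    push Not at h
    obtain ⟨kap, hk⟩ := h
    obtain ⟨h1, h2⟩ := mul_ne_zero_iff.1 hk
    have hc : Covers mu kap := by
      by_contra hc
      exact h1 (by simp [adj, hc])
    obtain ⟨h3, h4⟩ := ih h2
    refine ⟨fun i => (hc.1 i).trans (h3 i), ?_⟩
    rw [h4, hc.2]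
    omega

/-- The saturated chains of length `n` from `mu` to `lam`. -/
def chains (n : ℕ) (mu lam : IntPartition) : Set (ℕ → IntPartition) :=
  {f | f 0 = mu ∧ (∀ k, n ≤ k → f k = lam) ∧ ∀ k, k < n → Covers (f k) (f (k + 1))}

/-- A chain of length `n + 1` is a first step followed by a chain of length `n`. -/
def chainsSuccEquiv (n : ℕ) (mu lam : IntPartition) :
    chains (n + 1) mu lam ≃ Σ kap : {kap // Covers mu kap}, chains n kap lam where
  toFun f := ⟨⟨f.1 1, by have h := f.2.2.2 0 n.succ_pos; rwa [f.2.1] at h⟩,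
    fun k => f.1 (k + 1), rfl, fun k hk => f.2.2.1 (k + 1) (Nat.succ_le_succ hk),
    fun k hk => f.2.2.2 (k + 1) (Nat.succ_lt_succ hk)⟩
  invFun g := ⟨fun k => Nat.casesOn k mu g.2.1, rfl,
    fun k hk => by
      obtain _ | k := k
      · omega
      · exact g.2.2.2.1 k (by omega),
    fun k hk => by
      obtain _ | k := k
      · have h := g.1.2
        rwa [← g.2.2.1] at h
      · exact g.2.2.2.2 k (by omega)⟩
  left_inv f := by
    refine Subtype.ext (funext fun k => ?_)
    obtain _ | k := k
    · exact f.2.1.symm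
    · rfl
  right_inv g := by
    obtain ⟨⟨kap, hk⟩, ⟨g, hg⟩⟩ := g
    have h0 : g 0 = kap := hg.1
    subst h0
    rfl

theorem tsum_chains_one (n : ℕ) (mu lam : IntPartition) :
    ∑' _ : chains n mu lam, (1 : ℝ≥0∞) = chainCount n mu lam := by
  classical
  induction n generalizing mu with
  | zero =>
    rw [tsum_subtype (chains 0 mu lam) (fun _ => (1 : ℝ≥0∞))]
    simp only [Set.indicator_apply]
    rw [tsum_ite_of_subsingleton]
    · have h : (∃ f, f ∈ chains 0 mu lam) ↔ mu = lam :=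
        ⟨fun ⟨f, hf⟩ => hf.1.symm.trans (hf.2.1 0 le_rfl),
          fun h => ⟨fun _ => lam, h.symm, fun _ _ => rfl, fun _ hk => absurd hk (Nat.not_lt_zero _)⟩⟩
      simp only [h, chainCount]
    · exact fun f g hf hg => funext fun k =>
        (hf.2.1 k (Nat.zero_le k)).trans (hg.2.1 k (Nat.zero_le k)).symm
  | succ n ih =>
    rw [← (chainsSuccEquiv n mu lam).symm.tsum_eq, ENNReal.tsum_sigma']
    simp only [ih]
    rw [chainCount_succ]
    have h := tsum_subtype {kap | Covers mu kap} (fun kap => chainCount n kap lam)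
    refine h.trans (tsum_congr fun kap => ?_)
    simp [Set.indicator_apply, adj]

theorem skewDim_eq {mu lam : IntPartition}
    (h : chainCount (lam.size - mu.size) mu lam ≠ ∞) :
    (skewDim mu lam : ℝ≥0∞) = chainCount (lam.size - mu.size) mu lam := by
  rw [← tsum_chains_one] at h ⊢
  have hfin : Finite (chains (lam.size - mu.size) mu lam) := by
    by_contra hc
    rw [not_finite_iff_infinite] at hc
    exact h (ENNReal.tsum_const_eq_top_of_ne_zero one_ne_zero)
  have := Fintype.ofFinite (chains (lam.size - mu.size) mu lam)
  rw [tsum_fintype, Finset.sum_const, Finset.card_univ, ← Nat.card_eq_fintype_card]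
  simp only [nsmul_eq_mul, mul_one]
  rfl

theorem size_eq_zero_iff {lam : IntPartition} : lam.size = 0 ↔ lam.part 0 = 0 := by
  constructor
  · intro h
    by_contra hc
    let e : IntPartition := ⟨0, fun _ _ _ => le_rfl, by simp⟩
    have he : e.part = 0 := rfl
    have h0 := eq_of_le_of_size_le (mu := e) (lam := lam) (by simp [he]) (by omega)
    rw [← h0, he] at hc
    exact hc rfl
  · intro h
    rw [lam.size_eq_sum_range (N := 0) fun i _ => Nat.le_zero.1 (h ▸ lam.antitone (Nat.zero_le i))]
    rfl

/-- A partition with at most `n + 1` parts is obtained from one with at most `n` parts by adding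
`k` columns of height `n + 1`. -/
def atMostSuccEquiv (n : ℕ) :
    {lam : IntPartition // lam.part (n + 1) = 0} ≃ {lam : IntPartition // lam.part n = 0} × ℕ where
  toFun lam := ⟨⟨⟨fun i => lam.1.part i - lam.1.part n,
      fun _ _ hij => Nat.sub_le_sub_right (lam.1.antitone hij) _,
      lam.1.finite_supp.subset fun i hi hc => hi (by simp [hc])⟩, Nat.sub_self _⟩, lam.1.part n⟩
  invFun p := ⟨⟨fun i => p.1.1.part i + if i ≤ n then p.2 else 0,
      fun i j hij => by
        have h := p.1.1.antitone hij
        dsimp only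
        split_ifs <;> omega,
      (p.1.1.finite_supp.union (Set.finite_Iic n)).subset fun i hi => by
        by_contra hc
        rw [Set.mem_union, not_or] at hc
        have h1 : p.1.1.part i = 0 := by simpa using hc.1
        have h2 : ¬ i ≤ n := hc.2
        exact hi (by simp [h1, h2])⟩, by
      have h := p.1.1.antitone (Nat.le_succ n)
      rw [p.1.2] at h
      simpa using h⟩
  left_inv lam := by
    refine Subtype.ext (ext_part (funext fun i => ?_))
    dsimp only
    split_ifs with h
    · exact Nat.sub_add_cancel (lam.1.antitone h)
    · have h1 := lam.1.antitone (show n + 1 ≤ i by omega)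
      rw [lam.2] at h1
      omega
  right_inv p := by
    obtain ⟨⟨lam, hl⟩, k⟩ := p
    refine Prod.ext (Subtype.ext (ext_part (funext fun i => ?_))) ?_
    · dsimp only
      rw [hl]
      split_ifs with h1 h2 h2
      · omega
      · omega
      · have h3 := lam.antitone (show n ≤ i by omega)
        rw [hl] at h3
        omega
      · omega
    · simp [hl]

theorem size_atMostSuccEquiv_symm (n : ℕ) (p : {lam : IntPartition // lam.part n = 0} × ℕ) :
    ((atMostSuccEquiv n).symm p).1.size = p.1.1.size + (n + 1) * p.2 := by
  have h0 : ∀ i, n + 1 ≤ i → p.1.1.part i = 0 := fun i hi => by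
    have h := p.1.1.antitone (show n ≤ i by omega)
    rw [p.1.2] at h
    omega
  have h1 : ∀ i, n + 1 ≤ i → ((atMostSuccEquiv n).symm p).1.part i = 0 := fun i hi => by
    have h := ((atMostSuccEquiv n).symm p).1.antitone hi
    rw [((atMostSuccEquiv n).symm p).2] at h
    omega
  rw [size_eq_sum_range _ h0, size_eq_sum_range _ h1]
  have h2 : ∀ i ∈ Finset.range (n + 1),
      ((atMostSuccEquiv n).symm p).1.part i = p.1.1.part i + p.2 := fun i hi => by
    have hi' : i ≤ n := Nat.lt_succ_iff.1 (Finset.mem_range.1 hi)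
    simp [atMostSuccEquiv, hi']
  rw [Finset.sum_congr rfl h2, Finset.sum_add_distrib]
  simp

theorem tsum_pow_size_atMost (q : ℝ≥0∞) (n : ℕ) :
    ∑' lam : {lam : IntPartition // lam.part n = 0}, q ^ lam.1.size =
      ∏ k ∈ Finset.range n, (1 - q ^ (k + 1))⁻¹ := by
  induction n with
  | zero =>
    let e : IntPartition := ⟨0, fun _ _ _ => le_rfl, by simp⟩
    rw [tsum_eq_single ⟨e, rfl⟩]
    · simp [size_eq_zero_iff.2 (show e.part 0 = 0 from rfl)]
    · rintro ⟨lam, hl⟩ hne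
      refine absurd (Subtype.ext ?_) hne
      exact (eq_of_le_of_size_le (fun i => Nat.zero_le _) (by simp [size_eq_zero_iff.2 hl])).symm
  | succ n ih =>
    have h (p : {lam : IntPartition // lam.part n = 0} × ℕ) :
        q ^ ((atMostSuccEquiv n).symm p).1.size = q ^ p.1.1.size * (q ^ (n + 1)) ^ p.2 := by
      rw [size_atMostSuccEquiv_symm, pow_add, pow_mul]
    rw [← (atMostSuccEquiv n).symm.tsum_eq, Finset.prod_range_succ, ← ih, tsum_congr h,
      ENNReal.tsum_prod (f := fun (lam : {lam : IntPartition // lam.part n = 0}) k =>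
      q ^ lam.1.size * (q ^ (n + 1)) ^ k)]
    simp only [ENNReal.tsum_mul_left, ENNReal.tsum_mul_right, ENNReal.tsum_geometric]

theorem tsum_pow_size (q : ℝ≥0∞) :
    ∑' lam : IntPartition, q ^ lam.size =
      ⨆ n, ∏ k ∈ Finset.range n, (1 - q ^ (k + 1))⁻¹ := by
  classical
  simp only [← tsum_pow_size_atMost]
  apply le_antisymm
  · rw [ENNReal.tsum_eq_iSup_sum]
    refine iSup_le fun s => ?_
    choose N hN using exists_part_eq_zero
    refine le_trans ?_ (le_iSup _ (s.sup N))
    refine le_trans ?_ (tsum_subtype {lam : IntPartition | lam.part (s.sup N) = 0}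
      (fun lam => q ^ lam.size)).ge
    refine le_trans (Finset.sum_le_sum fun lam hl => ?_) (ENNReal.sum_le_tsum s)
    rw [Set.indicator_of_mem]
    exact hN lam _ (Finset.le_sup hl)
  · exact iSup_le fun n => ENNReal.tsum_comp_le_tsum_of_injective Subtype.val_injective _

theorem one_sub_pow_succ_pos {q : ℝ} (hq0 : 0 ≤ q) (hq1 : q < 1) (k : ℕ) :
    0 < 1 - q ^ (k + 1) :=
  sub_pos.2 (pow_lt_one₀ hq0 hq1 k.succ_ne_zero)

theorem multipliable_inv_one_sub_pow {q : ℝ} (hq0 : 0 ≤ q) (hq1 : q < 1) :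
    Multipliable fun k : ℕ => (1 - q ^ (k + 1))⁻¹ := by
  have hpos := one_sub_pow_succ_pos hq0 hq1
  have hq : 0 < 1 - q := sub_pos.2 hq1
  have hs : Summable fun k : ℕ => q ^ (k + 1) * (1 - q ^ (k + 1))⁻¹ := by
    refine Summable.of_nonneg_of_le
      (fun k => mul_nonneg (pow_nonneg hq0 _) (inv_pos.2 (hpos k)).le) (fun k => ?_)
      (((summable_nat_add_iff 1).2 (summable_geometric_of_lt_one hq0 hq1)).mul_right (1 - q)⁻¹)
    gcongr
    exact pow_le_of_le_one hq0 hq1.le k.succ_ne_zero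
  refine (Real.multipliable_one_add_of_summable hs).congr fun k => ?_
  have := (hpos k).ne'
  field_simp
  ring

theorem tprod_inv_one_sub_pow_nonneg {q : ℝ} (hq0 : 0 ≤ q) (hq1 : q < 1) :
    0 ≤ ∏' k : ℕ, (1 - q ^ (k + 1))⁻¹ :=
  tprod_nonneg fun k => (inv_pos.2 (one_sub_pow_succ_pos hq0 hq1 k)).le

theorem tsum_pow_size_ofReal {q : ℝ} (hq0 : 0 ≤ q) (hq1 : q < 1) :
    ∑' lam : IntPartition, ENNReal.ofReal q ^ lam.size =
      ENNReal.ofReal (∏' k : ℕ, (1 - q ^ (k + 1))⁻¹) := by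
  have hpos := one_sub_pow_succ_pos hq0 hq1
  have hterm (k : ℕ) : (1 - ENNReal.ofReal q ^ (k + 1))⁻¹ =
      ENNReal.ofReal (1 - q ^ (k + 1))⁻¹ := by
    rw [ENNReal.ofReal_inv_of_pos (hpos k), ENNReal.ofReal_sub _ (pow_nonneg hq0 _),
      ENNReal.ofReal_one, ENNReal.ofReal_pow hq0]
  rw [tsum_pow_size]
  have hmono : Monotone fun n => ∏ k ∈ Finset.range n, (1 - ENNReal.ofReal q ^ (k + 1))⁻¹ :=
    monotone_nat_of_le_succ fun n => by
      rw [Finset.prod_range_succ]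
      exact le_mul_of_one_le_right' (ENNReal.one_le_inv.2 tsub_le_self)
  refine tendsto_nhds_unique (tendsto_atTop_iSup hmono) ?_
  have h := (ENNReal.continuous_ofReal.tendsto _).comp (multipliable_inv_one_sub_pow hq0 hq1).tendsto_prod_tprod_nat
  refine h.congr fun n => ?_
  simp only [Function.comp, hterm]
  exact ENNReal.ofReal_prod_of_nonneg fun k _ => (inv_pos.2 (hpos k)).le

theorem chainCount_ne_top (n : ℕ) (mu lam : IntPartition) : chainCount n mu lam ≠ ∞ := by
  have hq : ENNReal.ofReal (1 / 2) ≠ 0 := by simp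
  have h := tsum_pow_size_mul_chainCount_sq (ENNReal.ofReal (1 / 2)) n
  rw [tsum_pow_size_ofReal (by norm_num) (by norm_num)] at h
  have hlt : (1 - ENNReal.ofReal (1 / 2))⁻¹ ≠ ∞ := by
    rw [ENNReal.inv_ne_top, ← ENNReal.ofReal_one, ← ENNReal.ofReal_sub _ (by norm_num)]
    norm_num
  have h1 : ∑' mu : IntPartition, ENNReal.ofReal (1 / 2) ^ mu.size *
      ∑' lam, chainCount n mu lam ^ 2 ≠ ∞ := by
    rw [h]
    exact ENNReal.mul_ne_top (ENNReal.mul_ne_top (ENNReal.natCast_ne_top _)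
      (ENNReal.pow_ne_top hlt)) ENNReal.ofReal_ne_top
  intro htop
  have h2 : ∑' lam, chainCount n mu lam ^ 2 = ∞ :=
    ENNReal.tsum_eq_top_of_eq_top ⟨lam, by simp [htop]⟩
  refine h1 (ENNReal.tsum_eq_top_of_eq_top ⟨mu, ?_⟩)
  rw [h2, ENNReal.mul_top (pow_ne_zero _ hq)]

open scoped Classical in
theorem ofReal_weight {q : ℝ} (hq0 : 0 ≤ q) (y : ℝ) (lam mu : IntPartition) :
    ENNReal.ofReal (if ∀ i : ℕ, mu.part i ≤ lam.part i then
        q ^ mu.size * (skewDim mu lam : ℝ) ^ 2 * y ^ (2 * (lam.size - mu.size)) /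
          (Nat.factorial (lam.size - mu.size) : ℝ) ^ 2
      else 0) =
      ∑' n : ℕ, ENNReal.ofReal ((y ^ 2) ^ n / (n.factorial : ℝ) ^ 2) *
        (ENNReal.ofReal q ^ mu.size * chainCount n mu lam ^ 2) := by
  split_ifs with h
  · rw [tsum_eq_single (lam.size - mu.size), ← skewDim_eq (chainCount_ne_top _ _ _),
      ← ENNReal.ofReal_pow hq0, ← ENNReal.ofReal_natCast, ← ENNReal.ofReal_pow (by positivity),
      ← ENNReal.ofReal_mul (by positivity), ← ENNReal.ofReal_mul (by positivity), pow_mul]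
    · congr 1
      ring
    · intro n hn
      by_contra hc
      have h0 : chainCount n mu lam ≠ 0 := fun h0 => hc (by simp [h0])
      have := (le_and_size_of_chainCount_ne_zero h0).2
      omega
  · rw [ENNReal.ofReal_zero]
    refine (ENNReal.tsum_eq_zero.2 fun n => ?_).symm
    by_contra hc
    have h0 : chainCount n mu lam ≠ 0 := fun h0 => hc (by simp [h0])
    exact h (le_and_size_of_chainCount_ne_zero h0).1

open scoped Classical in
theorem tsum_ofReal_weight {q : ℝ} (hq0 : 0 ≤ q) (hq1 : q < 1) (y : ℝ) :
    ∑' p : IntPartition × IntPartition,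
      ENNReal.ofReal (if ∀ i : ℕ, p.2.part i ≤ p.1.part i then
        q ^ p.2.size * (skewDim p.2 p.1 : ℝ) ^ 2 * y ^ (2 * (p.1.size - p.2.size)) /
          (Nat.factorial (p.1.size - p.2.size) : ℝ) ^ 2
      else 0) =
      ENNReal.ofReal (Real.exp (y ^ 2 / (1 - q)) * ∏' k : ℕ, (1 - q ^ (k + 1))⁻¹) := by
  have hq : 0 < 1 - q := by linarith
  have hexp : HasSum (fun n : ℕ => (y ^ 2 / (1 - q)) ^ n / n.factorial)
      (Real.exp (y ^ 2 / (1 - q))) := by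
    rw [Real.exp_eq_exp_ℝ]
    exact NormedSpace.expSeries_div_hasSum_exp _
  have hinv : (1 - ENNReal.ofReal q)⁻¹ = ENNReal.ofReal (1 - q)⁻¹ := by
    rw [ENNReal.ofReal_inv_of_pos hq, ENNReal.ofReal_sub _ hq0, ENNReal.ofReal_one]
  simp only [ofReal_weight hq0]
  rw [ENNReal.tsum_comm, ENNReal.ofReal_mul (Real.exp_pos _).le, ← tsum_pow_size_ofReal hq0 hq1,
    ← hexp.tsum_eq, ENNReal.ofReal_tsum_of_nonneg (fun n => by positivity) hexp.summable,
    ← ENNReal.tsum_mul_right]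
  refine tsum_congr fun n => ?_
  rw [ENNReal.tsum_mul_left, ENNReal.tsum_prod (f := fun lam mu : IntPartition =>
    ENNReal.ofReal q ^ mu.size * chainCount n mu lam ^ 2), ENNReal.tsum_comm]
  simp only [ENNReal.tsum_mul_left]
  rw [tsum_pow_size_mul_chainCount_sq, ← mul_assoc, hinv,
    ← ENNReal.ofReal_pow (inv_pos.2 hq).le, ← ENNReal.ofReal_natCast,
    ← ENNReal.ofReal_mul (by positivity), ← ENNReal.ofReal_mul (by positivity)]
  congr 2
  have := Nat.cast_ne_zero (R := ℝ).2 n.factorial_ne_zero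
  field_simp
  rw [← mul_pow, mul_one_div]

end IntPartition

open scoped Classical in
theorem cylindric_plancherel_partition_function (q y : ℝ) (hq0 : 0 ≤ q) (hq1 : q < 1) :
    Summable (fun p : IntPartition × IntPartition =>
      if ∀ i : ℕ, p.2.part i ≤ p.1.part i then
        q ^ p.2.size * (skewDim p.2 p.1 : ℝ) ^ 2 * y ^ (2 * (p.1.size - p.2.size)) /
          (Nat.factorial (p.1.size - p.2.size) : ℝ) ^ 2
      else 0) ∧
    (∑' lam : IntPartition, ∑' mu : IntPartition,
        if ∀ i : ℕ, mu.part i ≤ lam.part i then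
          q ^ mu.size * (skewDim mu lam : ℝ) ^ 2 * y ^ (2 * (lam.size - mu.size)) /
            (Nat.factorial (lam.size - mu.size) : ℝ) ^ 2
        else 0) =
      Real.exp (y ^ 2 / (1 - q)) * ∏' k : ℕ, (1 - q ^ (k + 1))⁻¹ := by
  have hnonneg : ∀ p : IntPartition × IntPartition,
      0 ≤ if ∀ i : ℕ, p.2.part i ≤ p.1.part i then
        q ^ p.2.size * (skewDim p.2 p.1 : ℝ) ^ 2 * y ^ (2 * (p.1.size - p.2.size)) /
          (Nat.factorial (p.1.size - p.2.size) : ℝ) ^ 2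
      else 0 := fun p => by
    rw [pow_mul]
    split_ifs <;> positivity
  have htsum := IntPartition.tsum_ofReal_weight hq0 hq1 y
  have hsum := ENNReal.summable_toReal (htsum.trans_ne ENNReal.ofReal_ne_top)
  simp only [ENNReal.toReal_ofReal (hnonneg _)] at hsum
  refine ⟨hsum, ?_⟩
  rw [← ENNReal.ofReal_tsum_of_nonneg hnonneg hsum] at htsum
  rw [← hsum.tsum_prod]
  refine (ENNReal.ofReal_eq_ofReal_iff (tsum_nonneg hnonneg) ?_).1 htsum
  exact mul_nonneg (Real.exp_pos _).le (IntPartition.tprod_inv_one_sub_pow_nonneg hq0 hq1)
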